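/- arXiv:1903.02956 — 5 statements merged into one kernel-verified Lean document; each statement's English description precedes it below -/
import Mathlib

section
/- If M > 0, m > 0 and I > 0, then for every real l and θ the 3×3 generalized inertia matrix M(l,θ) = [[M+m, m·sin θ, m·l·cos θ], [m·sin θ, m, 0], [m·l·cos θ, 0, m·l² + I]] is positive definite (in particular it is invertible even when the rope length l equals 0). -/
open Real Matrix

/-- The generalized inertia matrix of the overhead crane system. -/
noncomputable def inertiaMatrix (M m I l θ : ℝ) : Matrix (Fin 3) (Fin 3) ℝ :=
  !![M + m, m * Real.sin θ, m * l * Real.cos θ;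
     m * Real.sin θ, m, 0;
     m * l * Real.cos θ, 0, m * l ^ 2 + I]

/-- If `M > 0`, `m > 0` and `I > 0`, then for every real `l` and `θ` the generalized
inertia matrix `M(l,θ)` is positive definite; in particular it is invertible
(even when the rope length `l` equals `0`). -/
theorem inertiaMatrix_posDef (M m I : ℝ) (hM : 0 < M) (hm : 0 < m) (hI : 0 < I) :
    ∀ l θ : ℝ, (inertiaMatrix M m I l θ).PosDef ∧ IsUnit (inertiaMatrix M m I l θ) := by
  intro l θ
  have hP : (inertiaMatrix M m I l θ).PosDef := by
    refine Matrix.PosDef.of_dotProduct_mulVec_pos ?_ ?_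
    · ext i j
      fin_cases i <;> fin_cases j <;> simp [inertiaMatrix]
    · intro x hx
      -- complete the squares in the quadratic form
      have key : star x ⬝ᵥ (inertiaMatrix M m I l θ *ᵥ x) =
          M * x 0 ^ 2 + m * (x 0 * Real.sin θ + x 1) ^ 2
            + m * (x 0 * Real.cos θ + l * x 2) ^ 2 + I * x 2 ^ 2 := by
        simp [inertiaMatrix, Matrix.mulVec, dotProduct, Fin.sum_univ_three]
        linear_combination (-m * x 0 ^ 2) * Real.sin_sq_add_cos_sq θ
      rw [key]
      by_cases h0 : x 0 = 0
      · by_cases h2 : x 2 = 0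
        · have h1 : x 1 ≠ 0 := by
            intro h1
            apply hx
            ext i
            fin_cases i <;> simp [h0, h1, h2]
          simp only [h0, h2]
          have : 0 < m * x 1 ^ 2 := by positivity
          nlinarith
        · have : 0 < I * x 2 ^ 2 := by positivity
          positivity
      · have : 0 < M * x 0 ^ 2 := by positivity
        positivity
  exact ⟨hP, hP.isUnit⟩
end

section
/- Let M > 0, m > 0, I > 0 and let l, θ, v, ω, F_z, F_l, F_θ, g be real numbers. If (a, b, c) ∈ ℝ³ satisfies the linear system M(l,θ)·(a, b, c)ᵀ = (F_z + m·l·ω²·sin θ − 2m·v·ω·cos θ, F_l + m·l·ω² + g·m·cos θ, F_θ − 2m·l·v·ω − g·m·l·sin θ)ᵀ, where M(l,θ) = [[M+m, m·sin θ, m·l·cos θ], [m·sin θ, m, 0], [m·l·cos θ, 0, m·l² + I]], then the first component is a = −[cos θ·(F_θ·m·l + 2·I·m·v·ω) + sin θ·(F_l·m·l² + F_l·I + I·g·m·cos θ) − F_z·I − F_z·m·l²] / (M·m·l² + I·m·cos²θ + I·M). -/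
open Real Matrix

/-- If `(a, b, c)` solves the linear system giving the accelerations of the crane,
then the first component (the trolley acceleration) is given by the stated
explicit formula. -/
theorem crane_accel_first_component
    (M m I : ℝ) (hM : 0 < M) (hm : 0 < m) (hI : 0 < I)
    (l θ v ω Fz Fl Fθ g : ℝ) (a b c : ℝ)
    (h : (inertiaMatrix M m I l θ).mulVec ![a, b, c] =
      ![Fz + m * l * ω ^ 2 * Real.sin θ - 2 * m * v * ω * Real.cos θ,
        Fl + m * l * ω ^ 2 + g * m * Real.cos θ,
        Fθ - 2 * m * l * v * ω - g * m * l * Real.sin θ]) :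
    a = -(Real.cos θ * (Fθ * m * l + 2 * I * m * v * ω)
          + Real.sin θ * (Fl * m * l ^ 2 + Fl * I + I * g * m * Real.cos θ)
          - Fz * I - Fz * m * l ^ 2)
        / (M * m * l ^ 2 + I * m * (Real.cos θ) ^ 2 + I * M) := by
  have h0 := congrFun h 0
  have h1 := congrFun h 1
  have h2 := congrFun h 2
  simp [inertiaMatrix, Matrix.mulVec, dotProduct, Fin.sum_univ_three] at h0 h1 h2
  have hs := Real.sin_sq_add_cos_sq θ
  have hD : 0 < M * m * l ^ 2 + I * m * (Real.cos θ) ^ 2 + I * M := by positivity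
  rw [eq_div_iff hD.ne']
  linear_combination (m * l ^ 2 + I) * h0 - Real.sin θ * (m * l ^ 2 + I) * h1
    - m * l * Real.cos θ * h2 + m * (m * l ^ 2 + I) * a * hs
end

section
/- Let n ∈ ℕ, let A_cl, P, Q be real n×n matrices with P symmetric positive definite, Q symmetric, and P·A_cl + A_clᵀ·P = −Q. Let g : ℝⁿ → ℝⁿ with R(x) = g(x) − A_cl·x, and let σ > 0, Δ > 0, p₀ > 0, p > 0, q > 0 satisfy: ‖R(x)‖ ≤ σ‖x‖ for ‖x‖ ≤ Δ; p₀‖x‖² ≤ xᵀPx and ‖P·x‖ ≤ p‖x‖ for all x; q‖x‖² ≤ xᵀQx for all x; and q > 2σp. Suppose x : [0,∞) → ℝⁿ is differentiable with x′(t) = g(x(t)) and ‖x(t)‖ ≤ Δ for all t ≥ 0. Then, with α = (q − 2σp)/p, the Lyapunov function V(t) = x(t)ᵀP x(t) satisfies V(t) ≤ V(0)·e^{−αt} for all t ≥ 0, and consequently ‖x(t)‖² ≤ (p/p₀)‖x(0)‖²·e^{−αt} and x(t) → 0 as t → ∞. -/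
open Matrix Filter
open scoped InnerProductSpace Topology

/-- Local exponential stability via the quadratic Lyapunov function `V(x) = xᵀPx`:
along any trajectory of `ẋ = g(x)` staying in the ball `‖x‖ ≤ Δ`, one has
`V(t) ≤ V(0)·e^{−αt}` with `α = (q − 2σp)/p`, hence
`‖x(t)‖² ≤ (p/p₀)‖x(0)‖²·e^{−αt}` and `x(t) → 0` as `t → ∞`. -/
theorem lyapunov_exponential_stability {n : ℕ}
    (Acl P Q : Matrix (Fin n) (Fin n) ℝ)
    (hP : P.PosDef) (hQ : Q.IsSymm)
    (hLyap : P * Acl + Aclᵀ * P = -Q)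
    (g : EuclideanSpace ℝ (Fin n) → EuclideanSpace ℝ (Fin n))
    (σ Δ p₀ p q : ℝ) (hσ : 0 < σ) (hΔ : 0 < Δ) (hp₀ : 0 < p₀) (hp : 0 < p) (hq : 0 < q)
    (hR : ∀ x : EuclideanSpace ℝ (Fin n), ‖x‖ ≤ Δ →
      ‖g x - Matrix.toEuclideanLin Acl x‖ ≤ σ * ‖x‖)
    (hPlow : ∀ x : EuclideanSpace ℝ (Fin n), p₀ * ‖x‖ ^ 2 ≤ ⟪x, Matrix.toEuclideanLin P x⟫_ℝ)
    (hPbound : ∀ x : EuclideanSpace ℝ (Fin n), ‖Matrix.toEuclideanLin P x‖ ≤ p * ‖x‖)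
    (hQbound : ∀ x : EuclideanSpace ℝ (Fin n), q * ‖x‖ ^ 2 ≤ ⟪x, Matrix.toEuclideanLin Q x⟫_ℝ)
    (hqp : 2 * σ * p < q)
    (x : ℝ → EuclideanSpace ℝ (Fin n))
    (hderiv : ∀ t : ℝ, 0 ≤ t → HasDerivAt x (g (x t)) t)
    (hball : ∀ t : ℝ, 0 ≤ t → ‖x t‖ ≤ Δ) :
    (∀ t : ℝ, 0 ≤ t →
        ⟪x t, Matrix.toEuclideanLin P (x t)⟫_ℝ
          ≤ ⟪x 0, Matrix.toEuclideanLin P (x 0)⟫_ℝ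
              * Real.exp (-((q - 2 * σ * p) / p) * t)) ∧
      (∀ t : ℝ, 0 ≤ t →
        ‖x t‖ ^ 2 ≤ (p / p₀) * ‖x 0‖ ^ 2 * Real.exp (-((q - 2 * σ * p) / p) * t)) ∧
      Tendsto x atTop (𝓝 0) := by
  have hPT : Pᴴ = P := hP.isHermitian
  have hadj : ∀ (M : Matrix (Fin n) (Fin n) ℝ) (u v : EuclideanSpace ℝ (Fin n)),
      ⟪Matrix.toEuclideanLin M u, v⟫_ℝ = ⟪u, Matrix.toEuclideanLin Mᵀ v⟫_ℝ := by
    intro M u v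
    rw [← Matrix.conjTranspose_eq_transpose_of_trivial,
      Matrix.toEuclideanLin_conjTranspose_eq_adjoint, LinearMap.adjoint_inner_right]
  have hmul : ∀ (M N : Matrix (Fin n) (Fin n) ℝ) (u : EuclideanSpace ℝ (Fin n)),
      Matrix.toEuclideanLin M (Matrix.toEuclideanLin N u) = Matrix.toEuclideanLin (M * N) u := by
    intro M N u
    simp [Matrix.toLpLin_apply]
  have hPsymm : ∀ u v : EuclideanSpace ℝ (Fin n),
      ⟪u, Matrix.toEuclideanLin P v⟫_ℝ = ⟪v, Matrix.toEuclideanLin P u⟫_ℝ := by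
    intro u v
    rw [Matrix.conjTranspose_eq_transpose_of_trivial] at hPT
    have h := hadj P u v
    rw [hPT] at h
    rw [← h, real_inner_comm]
  have hkey : ∀ u : EuclideanSpace ℝ (Fin n),
      2 * ⟪Matrix.toEuclideanLin Acl u, Matrix.toEuclideanLin P u⟫_ℝ
        = -⟪u, Matrix.toEuclideanLin Q u⟫_ℝ := by
    intro u
    have h1 : ⟪Matrix.toEuclideanLin Acl u, Matrix.toEuclideanLin P u⟫_ℝ
        = ⟪u, Matrix.toEuclideanLin (Aclᵀ * P) u⟫_ℝ := by rw [hadj, hmul]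
    have h2 : ⟪Matrix.toEuclideanLin Acl u, Matrix.toEuclideanLin P u⟫_ℝ
        = ⟪u, Matrix.toEuclideanLin (P * Acl) u⟫_ℝ := by rw [hPsymm, hmul]
    have h3 : ⟪u, Matrix.toEuclideanLin (P * Acl + Aclᵀ * P) u⟫_ℝ
        = ⟪u, Matrix.toEuclideanLin (P * Acl) u⟫_ℝ
          + ⟪u, Matrix.toEuclideanLin (Aclᵀ * P) u⟫_ℝ := by
      rw [map_add, LinearMap.add_apply, inner_add_right]
    rw [hLyap, map_neg, LinearMap.neg_apply, inner_neg_right] at h3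
    linarith
  have hVup : ∀ u : EuclideanSpace ℝ (Fin n),
      ⟪u, Matrix.toEuclideanLin P u⟫_ℝ ≤ p * ‖u‖ ^ 2 := by
    intro u
    have h1 := real_inner_le_norm u (Matrix.toEuclideanLin P u)
    nlinarith [mul_le_mul_of_nonneg_left (hPbound u) (norm_nonneg u)]
  set α : ℝ := (q - 2 * σ * p) / p with hα
  have hαpos : 0 < α := div_pos (by linarith) hp
  have hαp : α * p = q - 2 * σ * p := by rw [hα]; field_simp
  have hdec : ∀ u : EuclideanSpace ℝ (Fin n), ‖u‖ ≤ Δ →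
      2 * ⟪g u, Matrix.toEuclideanLin P u⟫_ℝ ≤ -α * ⟪u, Matrix.toEuclideanLin P u⟫_ℝ := by
    intro u hu
    have h1 : ⟪g u, Matrix.toEuclideanLin P u⟫_ℝ
        = ⟪Matrix.toEuclideanLin Acl u, Matrix.toEuclideanLin P u⟫_ℝ
          + ⟪g u - Matrix.toEuclideanLin Acl u, Matrix.toEuclideanLin P u⟫_ℝ := by
      rw [inner_sub_left]; ring
    have h2 := real_inner_le_norm (g u - Matrix.toEuclideanLin Acl u) (Matrix.toEuclideanLin P u)
    have h3 := mul_le_mul (hR u hu) (hPbound u) (norm_nonneg _) (by positivity)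
    have h4 := hkey u
    have h5 := hQbound u
    have h6 := mul_le_mul_of_nonneg_left (hVup u) hαpos.le
    have h7 : α * (p * ‖u‖ ^ 2) = (q - 2 * σ * p) * ‖u‖ ^ 2 := by rw [← hαp]; ring
    nlinarith
  have hVd : ∀ t : ℝ, 0 ≤ t → HasDerivAt (fun s => ⟪x s, Matrix.toEuclideanLin P (x s)⟫_ℝ)
      (2 * ⟪g (x t), Matrix.toEuclideanLin P (x t)⟫_ℝ) t := by
    intro t ht
    have hL : HasDerivAt (fun s => Matrix.toEuclideanLin P (x s))
        (Matrix.toEuclideanLin P (g (x t))) t :=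
      (LinearMap.toContinuousLinearMap (Matrix.toEuclideanLin P)).hasFDerivAt.comp_hasDerivAt t
        (hderiv t ht)
    have h := (hderiv t ht).inner ℝ hL
    rw [hPsymm (x t)] at h
    rwa [two_mul]
  have hWd : ∀ t : ℝ, 0 ≤ t →
      HasDerivAt (fun s => ⟪x s, Matrix.toEuclideanLin P (x s)⟫_ℝ * Real.exp (α * s))
      (2 * ⟪g (x t), Matrix.toEuclideanLin P (x t)⟫_ℝ * Real.exp (α * t)
        + ⟪x t, Matrix.toEuclideanLin P (x t)⟫_ℝ * (Real.exp (α * t) * (α * 1))) t :=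
    fun t ht => (hVd t ht).mul (((hasDerivAt_id t).const_mul α).exp)
  have hanti : AntitoneOn
      (fun s => ⟪x s, Matrix.toEuclideanLin P (x s)⟫_ℝ * Real.exp (α * s)) (Set.Ici 0) := by
    apply antitoneOn_of_deriv_nonpos (convex_Ici 0)
    · exact fun t ht => (hWd t ht).continuousAt.continuousWithinAt
    · intro t ht
      rw [interior_Ici] at ht
      exact (hWd t (le_of_lt ht)).differentiableAt.differentiableWithinAt
    · intro t ht
      rw [interior_Ici] at ht
      have ht0 : 0 ≤ t := le_of_lt ht
      rw [(hWd t ht0).deriv]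
      have h := mul_le_mul_of_nonneg_right (hdec (x t) (hball t ht0)) (Real.exp_pos (α * t)).le
      nlinarith
  have hV : ∀ t : ℝ, 0 ≤ t → ⟪x t, Matrix.toEuclideanLin P (x t)⟫_ℝ
      ≤ ⟪x 0, Matrix.toEuclideanLin P (x 0)⟫_ℝ * Real.exp (-α * t) := by
    intro t ht
    have h := hanti (Set.mem_Ici.2 le_rfl) (Set.mem_Ici.2 ht) ht
    simp only [mul_zero, Real.exp_zero, mul_one] at h
    rw [neg_mul, Real.exp_neg, ← div_eq_mul_inv, le_div_iff₀ (Real.exp_pos _)]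
    exact h
  have hN : ∀ t : ℝ, 0 ≤ t →
      ‖x t‖ ^ 2 ≤ (p / p₀) * ‖x 0‖ ^ 2 * Real.exp (-α * t) := by
    intro t ht
    have h1 := hV t ht
    have h2 := hPlow (x t)
    have h3 := mul_le_mul_of_nonneg_right (hVup (x 0)) (Real.exp_pos (-α * t)).le
    have h4 : (p / p₀) * ‖x 0‖ ^ 2 * Real.exp (-α * t)
        = (p * ‖x 0‖ ^ 2 * Real.exp (-α * t)) / p₀ := by ring
    rw [h4, le_div_iff₀ hp₀]
    linarith
  refine ⟨hV, hN, ?_⟩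
  have hexp : Tendsto (fun t : ℝ => Real.exp (-α * t)) atTop (𝓝 0) :=
    Real.tendsto_exp_atBot.comp
      (tendsto_id.const_mul_atTop_of_neg (by linarith : -α < 0))
  have hb : Tendsto (fun t : ℝ => (p / p₀) * ‖x 0‖ ^ 2 * Real.exp (-α * t)) atTop (𝓝 0) := by
    simpa using hexp.const_mul ((p / p₀) * ‖x 0‖ ^ 2)
  have hsq : Tendsto (fun t : ℝ => ‖x t‖ ^ 2) atTop (𝓝 0) :=
    squeeze_zero' (Eventually.of_forall fun t => by positivity)
      ((eventually_ge_atTop 0).mono hN) hb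
  rw [tendsto_zero_iff_norm_tendsto_zero]
  have := hsq.sqrt
  simpa [Real.sqrt_sq] using this
end

section
/- Let g, l, m, M, I be real numbers with D := M·m·l² + I·(M+m) ≠ 0. Let A be the 4×4 real matrix with nonzero entries A(1,3) = 1, A(2,4) = 1, A(3,2) = g·l²·m²/D, A(4,2) = −g·l·m·(M+m)/D, and let B be the column vector (0, 0, (m·l² + I)/D, −l·m/D)ᵀ. Then the 4×4 controllability matrix C_{(A,B)} = (B AB A²B A³B) has determinant −g²·l⁴·m⁴ / D⁴. -/
open Matrix

/-- The state Jacobian `A = G_x(0,0)` of the crane model with constant rope length. -/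
noncomputable def craneAconst (g l m M I : ℝ) : Matrix (Fin 4) (Fin 4) ℝ :=
  !![0, 0, 1, 0;
     0, 0, 0, 1;
     0, g * l ^ 2 * m ^ 2 / (M * m * l ^ 2 + I * (M + m)), 0, 0;
     0, -(g * l * m * (M + m)) / (M * m * l ^ 2 + I * (M + m)), 0, 0]

/-- The input Jacobian `B = G_{u₁}(0,0)` of the crane model with constant rope length. -/
noncomputable def craneBconst (g l m M I : ℝ) : Fin 4 → ℝ :=
  ![0, 0, (m * l ^ 2 + I) / (M * m * l ^ 2 + I * (M + m)),
    -(l * m) / (M * m * l ^ 2 + I * (M + m))]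

/-- The Kalman controllability matrix `C_{(A,B)} = (B  AB  A²B  A³B)`. -/
noncomputable def craneKalmanConst (g l m M I : ℝ) : Matrix (Fin 4) (Fin 4) ℝ :=
  fun i j => ((craneAconst g l m M I ^ (j : ℕ)).mulVec (craneBconst g l m M I)) i

/-- The controllability matrix `(B  AB  A²B  A³B)` of the constant-rope-length crane
model has determinant `−g²·l⁴·m⁴ / D⁴` where `D = M·m·l² + I·(M+m)`. -/
theorem det_craneKalmanConst (g l m M I : ℝ)
    (hD : M * m * l ^ 2 + I * (M + m) ≠ 0) :
    (craneKalmanConst g l m M I).det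
      = -(g ^ 2 * l ^ 4 * m ^ 4) / (M * m * l ^ 2 + I * (M + m)) ^ 4 := by
  set D := M * m * l ^ 2 + I * (M + m) with hDdef
  set a := g * l ^ 2 * m ^ 2 / D with ha
  set b := -(g * l * m * (M + m)) / D with hb
  set p := (m * l ^ 2 + I) / D with hp
  set q := -(l * m) / D with hq
  have hA : craneAconst g l m M I = !![0, 0, 1, 0; 0, 0, 0, 1; 0, a, 0, 0; 0, b, 0, 0] := rfl
  have hB : craneBconst g l m M I = ![0, 0, p, q] := rfl
  have h1 : (craneAconst g l m M I).mulVec ![0, 0, p, q] = ![p, q, 0, 0] := by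
    rw [hA]; ext i; fin_cases i <;> simp [Matrix.mulVec, dotProduct, Fin.sum_univ_four]
  have h2 : (craneAconst g l m M I).mulVec ![p, q, 0, 0] = ![0, 0, a * q, b * q] := by
    rw [hA]; ext i; fin_cases i <;> simp [Matrix.mulVec, dotProduct, Fin.sum_univ_four]
  have h3 : (craneAconst g l m M I).mulVec ![0, 0, a * q, b * q] = ![a * q, b * q, 0, 0] := by
    rw [hA]; ext i; fin_cases i <;> simp [Matrix.mulVec, dotProduct, Fin.sum_univ_four]
  have hK : craneKalmanConst g l m M I
      = !![0, p, 0, a * q; 0, q, 0, b * q; p, 0, a * q, 0; q, 0, b * q, 0] := by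
    have e2 : (craneAconst g l m M I ^ 2).mulVec ![0, 0, p, q] = ![0, 0, a * q, b * q] := by
      rw [pow_two, ← Matrix.mulVec_mulVec, h1, h2]
    have e3 : (craneAconst g l m M I ^ 3).mulVec ![0, 0, p, q] = ![a * q, b * q, 0, 0] := by
      rw [pow_succ', ← Matrix.mulVec_mulVec, e2, h3]
    ext i j
    unfold craneKalmanConst
    rw [hB]
    fin_cases j
    · fin_cases i <;> simp
    · fin_cases i <;> simp [h1]
    · fin_cases i <;> simp [e2]
    · fin_cases i <;> simp [e3]
  have hd : p * (b * q) - q * (a * q) = g * l ^ 2 * m ^ 2 / D ^ 2 := by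
    rw [ha, hb, hp, hq]
    field_simp
    rw [hDdef]
    ring
  have hdet : (craneKalmanConst g l m M I).det = -(p * (b * q) - q * (a * q)) ^ 2 := by
    rw [hK]
    simp [Matrix.det_succ_row_zero, Fin.sum_univ_succ, Fin.succAbove]
    ring
  rw [hdet, hd]
  field_simp
end

section
/- Let g > 0, l > 0, m > 0, M > 0, I > 0 and set D = M·m·l² + I·(M+m). Let A be the 4×4 real matrix with nonzero entries A(1,3) = 1, A(2,4) = 1, A(3,2) = g·l²·m²/D, A(4,2) = −g·l·m·(M+m)/D, and let B = (0, 0, (m·l² + I)/D, −l·m/D)ᵀ. Then the controllability matrix (B AB A²B A³B) is invertible (has rank 4); i.e., the pair (A,B) is controllable. -/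
open Matrix

/-- The Kalman matrix of a pair with the sparsity pattern of the crane model. -/
theorem crane_aux (a d b c : ℝ) :
    (Matrix.of fun i j : Fin 4 => (((!![0, 0, 1, 0; 0, 0, 0, 1; 0, a, 0, 0; 0, d, 0, 0] :
      Matrix (Fin 4) (Fin 4) ℝ) ^ (j : ℕ)).mulVec ![0, 0, b, c]) i) =
    !![0, b, 0, a * c; 0, c, 0, d * c; b, 0, a * c, 0; c, 0, d * c, 0] := by
  ext i j
  fin_cases j <;> fin_cases i <;>
    simp [pow_succ, ← Matrix.mulVec_mulVec, Matrix.mulVec, dotProduct, Fin.sum_univ_four]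

theorem crane_det (a d b c : ℝ) :
    (!![0, b, 0, a * c; 0, c, 0, d * c; b, 0, a * c, 0; c, 0, d * c, 0] :
      Matrix (Fin 4) (Fin 4) ℝ).det = -(c * (b * d - a * c)) ^ 2 := by
  simp [Matrix.det_succ_row_zero, Fin.sum_univ_succ, Fin.succAbove]
  ring

/-- For positive parameters, the controllability matrix `(B  AB  A²B  A³B)` of the
constant-rope-length crane model is invertible (has rank 4); i.e. the pair `(A,B)`
is controllable. -/
theorem craneKalmanConst_controllable (g l m M I : ℝ)
    (hg : 0 < g) (hl : 0 < l) (hm : 0 < m) (hM : 0 < M) (hI : 0 < I) :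
    IsUnit (craneKalmanConst g l m M I) ∧ (craneKalmanConst g l m M I).rank = 4 := by
  have hD : 0 < M * m * l ^ 2 + I * (M + m) := by positivity
  have hdet : (craneKalmanConst g l m M I).det ≠ 0 := by
    have h := crane_det (g * l ^ 2 * m ^ 2 / (M * m * l ^ 2 + I * (M + m)))
      (-(g * l * m * (M + m)) / (M * m * l ^ 2 + I * (M + m)))
      ((m * l ^ 2 + I) / (M * m * l ^ 2 + I * (M + m)))
      (-(l * m) / (M * m * l ^ 2 + I * (M + m)))
    rw [← crane_aux] at h
    change (craneKalmanConst g l m M I).det = _ at h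
    rw [h]
    have e : (-(l * m) / (M * m * l ^ 2 + I * (M + m))) *
        ((m * l ^ 2 + I) / (M * m * l ^ 2 + I * (M + m)) *
          (-(g * l * m * (M + m)) / (M * m * l ^ 2 + I * (M + m))) -
        g * l ^ 2 * m ^ 2 / (M * m * l ^ 2 + I * (M + m)) *
          (-(l * m) / (M * m * l ^ 2 + I * (M + m)))) =
        g * (l * m) ^ 2 / (M * m * l ^ 2 + I * (M + m)) ^ 2 := by
      have hD' := hD.ne'
      field_simp
      ring
    rw [e, neg_ne_zero]
    positivity
  have hu : IsUnit (craneKalmanConst g l m M I) :=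
    (Matrix.isUnit_iff_isUnit_det _).2 (isUnit_iff_ne_zero.2 hdet)
  exact ⟨hu, by simpa using Matrix.rank_of_isUnit _ hu⟩
end
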